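/- Let α,β,γ > 0 with α+β+γ < 1 and R(C,L,K) = (1/(αβγ)) C^α L^β K^γ (Cobb–Douglas with zero shift). Then for C, w, r > 0 the supremum defining ~R(C,w,r) = sup_{L,K>0}[R(C,L,K) − wL − rK] is attained, ~R(·,w,r) is differentiable, and ∂~R/∂C (C,w,r) = [ (1/(βγ)) (β/(αw))^β (γ/(αr))^γ C^{α+β+γ−1} ]^{1/(1−β−γ)}. -/

import Mathlib

open Set Filter

/-- The Cobb–Douglas production function with zero shift
`R(C,L,K) = (1/(αβγ)) C^α L^β K^γ` (real powers). -/
noncomputable def cobbDouglas (α β γ C L K : ℝ) : ℝ :=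
  (1 / (α * β * γ)) * C ^ α * L ^ β * K ^ γ

/-- The reduced production function
`~R(C,w,r) = sup_{L,K > 0} [R(C,L,K) - wL - rK]` for the Cobb–Douglas `R`. -/
noncomputable def tRCobbDouglas (α β γ w r C : ℝ) : ℝ :=
  sSup ((fun q : ℝ × ℝ => cobbDouglas α β γ C q.1 q.2 - w * q.1 - r * q.2) ''
    (Ioi 0 ×ˢ Ioi 0))

/-- A critical point of the profit, at which labour and capital are paid the shares `β` and `γ` of
the output `Y`, maximizes the profit. -/
theorem isGreatest_cobbDouglas_profit {α β γ C w r Y : ℝ} (hβ : 0 < β) (hγ : 0 < γ)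
    (hβγ : β + γ < 1) (hw : 0 < w) (hr : 0 < r) (hY : 0 < Y)
    (h : cobbDouglas α β γ C (β * Y / w) (γ * Y / r) = Y) :
    IsGreatest ((fun q : ℝ × ℝ => cobbDouglas α β γ C q.1 q.2 - w * q.1 - r * q.2) ''
      (Ioi 0 ×ˢ Ioi 0)) ((1 - β - γ) * Y) := by
  refine ⟨⟨(β * Y / w, γ * Y / r), ⟨mem_Ioi.2 (by positivity), mem_Ioi.2 (by positivity)⟩, ?_⟩, ?_⟩
  · simp only [h]
    field_simp
  · rintro _ ⟨⟨L, K⟩, ⟨hL, hK⟩, rfl⟩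
    simp only [mem_Ioi] at hL hK ⊢
    obtain ⟨x, hx, rfl⟩ : ∃ x, 0 < x ∧ L = β * Y / w * x :=
      ⟨L / (β * Y / w), by positivity, by field_simp⟩
    obtain ⟨y, hy, rfl⟩ : ∃ y, 0 < y ∧ K = γ * Y / r * y :=
      ⟨K / (γ * Y / r), by positivity, by field_simp⟩
    have hscale : cobbDouglas α β γ C (β * Y / w * x) (γ * Y / r * y) = Y * (x ^ β * y ^ γ) := by
      unfold cobbDouglas at h ⊢
      rw [Real.mul_rpow (by positivity) hx.le, Real.mul_rpow (by positivity) hy.le]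
      linear_combination (x ^ β * y ^ γ) * h
    have hamgm := Real.geom_mean_le_arith_mean3_weighted hβ.le hγ.le
      (by linarith : 0 ≤ 1 - β - γ) hx.le hy.le zero_le_one (by ring)
    rw [Real.one_rpow, mul_one, mul_one] at hamgm
    have hwL : w * (β * Y / w * x) = Y * (β * x) := by field_simp
    have hrK : r * (γ * Y / r * y) = Y * (γ * y) := by field_simp
    rw [hscale, hwL, hrK]
    linarith [mul_le_mul_of_nonneg_left hamgm hY.le]

/-- The output `c * D / α` satisfies the first-order conditions, where `D` is the marginal
reduced production. -/
theorem cobbDouglas_eq_of_rpow_eq {α β γ w r c D : ℝ} (hα : 0 < α) (hβ : 0 < β) (hγ : 0 < γ)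
    (hw : 0 < w) (hr : 0 < r) (hc : 0 < c) (hD : 0 < D)
    (h : D ^ (1 - β - γ) =
      1 / (β * γ) * (β / (α * w)) ^ β * (γ / (α * r)) ^ γ * c ^ (α + β + γ - 1)) :
    cobbDouglas α β γ c (β * (c * D / α) / w) (γ * (c * D / α) / r) = c * D / α := by
  have hL : β * (c * D / α) / w = β / (α * w) * c * D := by field_simp
  have hK : γ * (c * D / α) / r = γ / (α * r) * c * D := by field_simp
  have hcpow : c ^ α * c ^ β * c ^ γ = c * c ^ (α + β + γ - 1) := by
    rw [← Real.rpow_add hc, ← Real.rpow_add hc, Real.rpow_sub_one hc.ne']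
    field_simp
  have hDpow : D ^ (1 - β - γ) * D ^ β * D ^ γ = D := by
    rw [← Real.rpow_add hD, ← Real.rpow_add hD]
    ring_nf
    exact Real.rpow_one D
  unfold cobbDouglas
  rw [hL, hK, Real.mul_rpow (by positivity) hD.le, Real.mul_rpow (by positivity) hc.le,
    Real.mul_rpow (by positivity) hD.le, Real.mul_rpow (by positivity) hc.le]
  calc _ = 1 / α * (1 / (β * γ) * (β / (α * w)) ^ β * (γ / (α * r)) ^ γ) *
        (c ^ α * c ^ β * c ^ γ) * D ^ β * D ^ γ := by
        field_simp
    _ = c / α * (D ^ (1 - β - γ) * D ^ β * D ^ γ) := by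
        rw [hcpow, h]; ring
    _ = c * D / α := by
        rw [hDpow]; ring

/-- Remark 2.2 of the paper. For Cobb–Douglas
`R(C,L,K) = (1/(αβγ)) C^α L^β K^γ` with `α,β,γ > 0`, `α+β+γ < 1`, and `C,w,r > 0`,
the supremum defining `~R(C,w,r)` is attained, `~R(·,w,r)` is differentiable, and
`∂~R/∂C(C,w,r) = [(1/(βγ)) (β/(αw))^β (γ/(αr))^γ C^{α+β+γ-1}]^{1/(1-β-γ)}`. -/
theorem statement_2 (α β γ : ℝ) (hα : 0 < α) (hβ : 0 < β) (hγ : 0 < γ)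
    (hαβγ : α + β + γ < 1) (C w r : ℝ) (hC : 0 < C) (hw : 0 < w) (hr : 0 < r) :
    -- the supremum is attained
    (∃ q : ℝ × ℝ, q ∈ Ioi (0:ℝ) ×ˢ Ioi (0:ℝ) ∧
      tRCobbDouglas α β γ w r C = cobbDouglas α β γ C q.1 q.2 - w * q.1 - r * q.2 ∧
      ∀ q' ∈ Ioi (0:ℝ) ×ˢ Ioi (0:ℝ),
        cobbDouglas α β γ C q'.1 q'.2 - w * q'.1 - r * q'.2 ≤ tRCobbDouglas α β γ w r C) ∧
    -- differentiability and the formula for `~R_C`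
    HasDerivAt (fun c => tRCobbDouglas α β γ w r c)
      ((1 / (β * γ) * (β / (α * w)) ^ β * (γ / (α * r)) ^ γ * C ^ (α + β + γ - 1)) ^
        (1 / (1 - β - γ))) C := by
  have hδ : 0 < 1 - β - γ := by linarith
  set M := 1 / (β * γ) * (β / (α * w)) ^ β * (γ / (α * r)) ^ γ
  have hMpos : 0 < M := by positivity
  have hgreatest : ∀ c : ℝ, 0 < c → IsGreatest
      ((fun q : ℝ × ℝ => cobbDouglas α β γ c q.1 q.2 - w * q.1 - r * q.2) '' (Ioi 0 ×ˢ Ioi 0))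
      ((1 - β - γ) * (c * (M * c ^ (α + β + γ - 1)) ^ (1 / (1 - β - γ)) / α)) := by
    intro c hc
    refine isGreatest_cobbDouglas_profit hβ hγ (by linarith) hw hr (by positivity)
      (cobbDouglas_eq_of_rpow_eq hα hβ hγ hw hr hc (by positivity) ?_)
    rw [← Real.rpow_mul (by positivity), one_div_mul_cancel hδ.ne', Real.rpow_one]
  refine ⟨?_, ?_⟩
  · have hC' := hgreatest C hC
    have hsup : tRCobbDouglas α β γ w r C = _ := hC'.csSup_eq
    obtain ⟨⟨q, hq, hqv⟩, hub⟩ := hC'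
    exact ⟨q, hq, hsup.trans hqv.symm,
      fun q' hq' => (hub (mem_image_of_mem _ hq')).trans_eq hsup.symm⟩
  · have hpow : ∀ c : ℝ, 0 < c → (M * c ^ (α + β + γ - 1)) ^ (1 / (1 - β - γ)) =
        M ^ (1 / (1 - β - γ)) * c ^ (α / (1 - β - γ) - 1) := by
      intro c hc
      rw [Real.mul_rpow hMpos.le (by positivity), ← Real.rpow_mul hc.le]
      congr 2
      field_simp
      ring
    have hderiv := (Real.hasDerivAt_rpow_const (x := C) (p := α / (1 - β - γ))
      (Or.inl hC.ne')).const_mul ((1 - β - γ) / α * M ^ (1 / (1 - β - γ)))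
    rw [hpow C hC]
    refine (hderiv.congr_of_eventuallyEq ?_).congr_deriv ?_
    · filter_upwards [lt_mem_nhds hC] with c hc
      refine (hgreatest c hc).csSup_eq.trans ?_
      rw [hpow c hc, Real.rpow_sub_one hc.ne']
      field_simp
    · field_simp
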